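/- If Δ is an Eulerian sphere, then Δ has Property E, i.e. e_k(Δ) = (−1)^{d−k} f_{k−1}(Δ) for all 0 ≤ k ≤ d. -/

import Mathlib

/-- `f_{i-1}(Γ)`: the number of faces of `Γ` of cardinality `i`. -/
def faceCount (n : ℕ) (Γ : Finset (Finset (Fin n))) (i : ℕ) : ℕ :=
  (Γ.filter fun σ => σ.card = i).card

/-- The `e`-vector: `e_k(Δ) = ∑_{i=k}^{d} (−1)^{i−k} (i choose k) f_{i−1}(Δ)`. -/
def eVec (n d : ℕ) (Δ : Finset (Finset (Fin n))) (k : ℕ) : ℤ :=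
  ∑ i ∈ Finset.Icc k d, (-1) ^ (i - k) * (i.choose k : ℤ) * (faceCount n Δ i : ℤ)

/-- The reduced Euler characteristic `χ̃(Γ) = ∑_{i ≥ 0} (−1)^i f_i(Γ)`
(here `f_i` counts faces of cardinality `i+1`, which is at most `n`). -/
def redEuler (n : ℕ) (Γ : Finset (Finset (Fin n))) : ℤ :=
  ∑ i ∈ Finset.range n, (-1) ^ i * (faceCount n Γ (i + 1) : ℤ)

/-- The link of a face `σ`: `Lk σ = {τ ∈ Δ : τ ∩ σ = ∅ and τ ∪ σ ∈ Δ}`. -/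
def linkFace (n : ℕ) (Δ : Finset (Finset (Fin n))) (σ : Finset (Fin n)) :
    Finset (Finset (Fin n)) :=
  Δ.filter fun τ => τ ∩ σ = ∅ ∧ τ ∪ σ ∈ Δ

theorem sum_mul_faceCount (n : ℕ) (Γ : Finset (Finset (Fin n))) (s : Finset ℕ)
    (hs : ∀ σ ∈ Γ, σ.card ∈ s) (g : ℕ → ℤ) :
    ∑ i ∈ s, g i * (faceCount n Γ i : ℤ) = ∑ σ ∈ Γ, g σ.card := by
  rw [← Finset.sum_fiberwise_of_maps_to hs]
  refine Finset.sum_congr rfl fun i _ => ?_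
  rw [Finset.sum_congr rfl (g := fun _ => g i)
    (fun σ hσ => by rw [(Finset.mem_filter.1 hσ).2])]
  simp [faceCount, mul_comm]

theorem faceCount_zero (n : ℕ) (Γ : Finset (Finset (Fin n))) (h : ∅ ∈ Γ) :
    faceCount n Γ 0 = 1 := by
  rw [faceCount, Finset.card_eq_one]
  refine ⟨∅, ?_⟩
  ext σ
  simp only [Finset.mem_filter, Finset.card_eq_zero, Finset.mem_singleton]
  exact ⟨fun hσ => hσ.2, fun hσ => ⟨hσ ▸ h, hσ⟩⟩

theorem sum_neg_one_pow_card_eq (n : ℕ) (Γ : Finset (Finset (Fin n))) (h : ∅ ∈ Γ) :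
    ∑ σ ∈ Γ, (-1 : ℤ) ^ σ.card = 1 - redEuler n Γ := by
  have hs : ∀ σ ∈ Γ, σ.card ∈ Finset.range (n + 1) := fun σ _ => by
    have := Finset.card_le_univ σ
    rw [Fintype.card_fin] at this
    exact Finset.mem_range.2 (by lia)
  rw [← sum_mul_faceCount n Γ _ hs (fun i => (-1) ^ i), Finset.sum_range_succ',
    faceCount_zero n Γ h, redEuler, sub_eq_add_neg, ← Finset.sum_neg_distrib, add_comm]
  simp [pow_succ]

theorem sum_linkFace (n : ℕ) (Δ : Finset (Finset (Fin n)))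
    (hdown : ∀ σ ∈ Δ, ∀ τ ⊆ σ, τ ∈ Δ) (σ : Finset (Fin n)) :
    ∑ τ ∈ linkFace n Δ σ, (-1 : ℤ) ^ τ.card =
      ∑ ρ ∈ Δ with σ ⊆ ρ, (-1 : ℤ) ^ (ρ.card + σ.card) := by
  refine Finset.sum_bij' (fun τ _ => τ ∪ σ) (fun ρ _ => ρ \ σ) ?_ ?_ ?_ ?_ ?_
  · intro τ hτ
    simp only [linkFace, Finset.mem_filter] at hτ
    exact Finset.mem_filter.2 ⟨hτ.2.2, Finset.subset_union_right⟩
  · intro ρ hρ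
    rw [Finset.mem_filter] at hρ
    simp only [linkFace, Finset.mem_filter]
    refine ⟨hdown ρ hρ.1 _ Finset.sdiff_subset, Finset.sdiff_inter_self _ _, ?_⟩
    rw [Finset.sdiff_union_of_subset hρ.2]
    exact hρ.1
  · intro τ hτ
    simp only [linkFace, Finset.mem_filter] at hτ
    exact Finset.union_sdiff_cancel_right (Finset.disjoint_iff_inter_eq_empty.2 hτ.2.1)
  · intro ρ hρ
    exact Finset.sdiff_union_of_subset (Finset.mem_filter.1 hρ).2
  · intro τ hτ
    simp only [linkFace, Finset.mem_filter] at hτ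
    rw [Finset.card_union_of_disjoint (Finset.disjoint_iff_inter_eq_empty.2 hτ.2.1),
      add_assoc, pow_add, ← two_mul]
    simp

theorem eVec_eq_sum_sum (n d : ℕ) (Δ : Finset (Finset (Fin n)))
    (hdown : ∀ σ ∈ Δ, ∀ τ ⊆ σ, τ ∈ Δ) (hdim : ∀ σ ∈ Δ, σ.card ≤ d) (k : ℕ) :
    eVec n d Δ k = ∑ σ ∈ Δ with σ.card = k, ∑ ρ ∈ Δ with σ ⊆ ρ,
      (-1 : ℤ) ^ (ρ.card + σ.card) := by
  have h1 : eVec n d Δ k = ∑ i ∈ Finset.range (d + 1),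
      ((-1) ^ (i + k) * (i.choose k : ℤ)) * (faceCount n Δ i : ℤ) := by
    rw [eVec]
    refine Finset.sum_subset_zero_on_sdiff (fun i hi => ?_) (fun i hi => ?_) (fun i hi => ?_)
    · simp only [Finset.mem_Icc, Finset.mem_range] at *
      lia
    · simp only [Finset.mem_sdiff, Finset.mem_Icc, Finset.mem_range] at hi
      rw [Nat.choose_eq_zero_of_lt (by lia)]
      simp
    · obtain ⟨j, rfl⟩ := Nat.exists_eq_add_of_le (Finset.mem_Icc.1 hi).1
      rw [Nat.add_sub_cancel_left, add_right_comm, pow_add _ (k + k), ← two_mul]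
      simp
  rw [h1, sum_mul_faceCount n Δ _ (fun σ hσ => Finset.mem_range.2 (Nat.lt_succ_of_le (hdim σ hσ)))
    (fun i => (-1) ^ (i + k) * (i.choose k : ℤ)),
    Finset.sum_comm' (t' := Δ) (s' := fun ρ => ρ.powersetCard k)]
  · refine Finset.sum_congr rfl fun ρ _ => ?_
    rw [Finset.sum_congr rfl (g := fun _ => (-1 : ℤ) ^ (ρ.card + k))
      (fun σ hσ => by rw [(Finset.mem_powersetCard.1 hσ).2])]
    simp [mul_comm]
  · intro σ ρ
    simp only [Finset.mem_filter, Finset.mem_powersetCard]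
    exact ⟨fun h => ⟨⟨h.2.2, h.1.2⟩, h.2.1⟩,
      fun h => ⟨⟨hdown ρ h.2 σ h.1.1, h.1.2⟩, h.2, h.1.1⟩⟩

theorem eulerian_sphere_implies_propertyE
    (n d : ℕ) (Δ : Finset (Finset (Fin n)))
    (hempty : ∅ ∈ Δ)
    (hdown : ∀ σ ∈ Δ, ∀ τ ⊆ σ, τ ∈ Δ)
    (hd : 1 ≤ d)
    (hdim : ∀ σ ∈ Δ, σ.card ≤ d)
    (hmax : ∃ σ ∈ Δ, σ.card = d)
    (hpure : ∀ σ ∈ Δ, ∃ τ ∈ Δ, σ ⊆ τ ∧ τ.card = d)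
    (heuler : ∀ σ ∈ Δ, σ ≠ ∅ →
      redEuler n (linkFace n Δ σ) = 1 + (Int.negOnePow ((d : ℤ) - 1 - σ.card) : ℤ))
    (hsphere : redEuler n Δ = 1 + (-1) ^ (d - 1)) :
    ∀ k ≤ d, eVec n d Δ k = (-1) ^ (d - k) * (faceCount n Δ k : ℤ) := by
  have hstar : ∀ σ ∈ Δ, ∑ ρ ∈ Δ with σ ⊆ ρ, (-1 : ℤ) ^ (ρ.card + σ.card) =
      (-1) ^ (d - σ.card) := by
    intro σ hσ
    rcases eq_or_ne σ ∅ with rfl | hne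
    · obtain ⟨m, rfl⟩ := Nat.exists_eq_add_of_le hd
      have := sum_neg_one_pow_card_eq n Δ hempty
      rw [hsphere] at this
      simp only [Finset.empty_subset, Finset.filter_true, Finset.card_empty, add_zero,
        Nat.sub_zero, this, Nat.add_sub_cancel_left]
      ring
    · have hlink : ∅ ∈ linkFace n Δ σ := by
        simp [linkFace, hempty, hσ]
      rw [← sum_linkFace n Δ hdown, sum_neg_one_pow_card_eq n _ hlink, heuler σ hσ hne]
      obtain ⟨m, hm⟩ := Nat.exists_eq_add_of_le (hdim σ hσ)
      have hexp : (d : ℤ) - 1 - σ.card = (m : ℤ) - 1 := by rw [hm]; push_cast; ring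
      have hsub : d - σ.card = m := by lia
      rw [hexp, hsub, Int.negOnePow_sub, Int.negOnePow_one]
      simp [Int.negOnePow_def]
  intro k _
  rw [eVec_eq_sum_sum n d Δ hdown hdim, Finset.sum_congr rfl (g := fun _ => (-1 : ℤ) ^ (d - k))
    (fun σ hσ => by
      rw [Finset.mem_filter] at hσ
      rw [hstar σ hσ.1, hσ.2])]
  simp [faceCount, mul_comm]
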